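/- (Rayleigh-averaged Q-function.) Let Ω > 0 and χ > 0, and set μ = √(χ²Ω/(2 + χ²Ω)). Then ∫₀^∞ (2b/Ω) e^{-b²/Ω} Q(χ b) db = (1/2)·(1 − μ). In particular, for χ = λ/σ with λ, σ > 0 and γ̄ = Ω/σ², one has E_β[Q(βλ/σ)] = (1/2)(1 − √(λ²γ̄/(2 + λ²γ̄))). -/

import Mathlib

open MeasureTheory Real Filter Set

noncomputable def Phi (x : ℝ) : ℝ :=
  ∫ t in Set.Iic x, (Real.sqrt (2 * Real.pi))⁻¹ * Real.exp (-t ^ 2 / 2)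

noncomputable def Q (x : ℝ) : ℝ := 1 - Phi x

noncomputable def gaussPDF (σ n : ℝ) : ℝ :=
  (σ * Real.sqrt (2 * Real.pi))⁻¹ * Real.exp (-n ^ 2 / (2 * σ ^ 2))

noncomputable def E1 (x : ℝ) : ℝ := ∫ t in Set.Ioi x, Real.exp (-t) / t


lemma gint : Integrable (fun t : ℝ => (Real.sqrt (2 * Real.pi))⁻¹ * Real.exp (-t ^ 2 / 2)) := by
  have h := (integrable_exp_neg_mul_sq (b := 1/2) (by norm_num)).const_mul (Real.sqrt (2 * Real.pi))⁻¹
  convert h using 4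
  ring

lemma gtot : ∫ t : ℝ, (Real.sqrt (2 * Real.pi))⁻¹ * Real.exp (-t ^ 2 / 2) = 1 := by
  have h := integral_gaussian (1/2)
  have e : ∀ t : ℝ, -t ^ 2 / 2 = -(1/2) * t ^ 2 := fun t => by ring
  simp_rw [e]
  rw [integral_const_mul, h, show π / (1/2) = 2 * π by ring]
  exact inv_mul_cancel₀ (by positivity)

lemma Phi_zero : Phi 0 = 1 / 2 := by
  unfold Phi
  have h := integral_comp_neg_Ioi (0:ℝ) (fun t : ℝ => (Real.sqrt (2 * Real.pi))⁻¹ * Real.exp (-t ^ 2 / 2))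
  rw [neg_zero] at h
  rw [← h]
  have e : ∀ t : ℝ, -(-t) ^ 2 / 2 = -(1/2) * t ^ 2 := fun t => by ring
  simp_rw [e]
  rw [integral_const_mul, integral_gaussian_Ioi, show π / (1/2) = 2 * π by ring]
  have : √(2 * π) ≠ 0 := by positivity
  field_simp

lemma Phi_nonneg (x : ℝ) : 0 ≤ Phi x :=
  setIntegral_nonneg measurableSet_Iic (fun t _ => by positivity)

lemma Phi_le_one (x : ℝ) : Phi x ≤ 1 := by
  rw [← gtot]
  exact setIntegral_le_integral gint (Eventually.of_forall fun t => by positivity)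

lemma Phi_deriv (x : ℝ) :
    HasDerivAt Phi ((Real.sqrt (2 * Real.pi))⁻¹ * Real.exp (-x ^ 2 / 2)) x := by
  have e : Phi = fun x => Phi 0 + ∫ t in (0:ℝ)..x, (Real.sqrt (2 * Real.pi))⁻¹ * Real.exp (-t ^ 2 / 2) := by
    funext y
    have := intervalIntegral.integral_Iic_sub_Iic (a := 0) (b := y) gint.integrableOn gint.integrableOn
    rw [← this]; unfold Phi; ring
  rw [e]
  have hc : Continuous (fun t : ℝ => (Real.sqrt (2 * Real.pi))⁻¹ * Real.exp (-t ^ 2 / 2)) := by fun_prop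
  exact (hc.integral_hasStrictDerivAt 0 x).hasDerivAt.const_add _

lemma main_int (Ω χ : ℝ) (hΩ : 0 < Ω) (hχ : 0 < χ) :
    (∫ b in Set.Ioi (0:ℝ), (2 * b / Ω) * Real.exp (-b ^ 2 / Ω) * Q (χ * b))
      = 1 / 2 * (1 - Real.sqrt (χ ^ 2 * Ω / (2 + χ ^ 2 * Ω))) := by
  set c : ℝ := 1 / Ω + χ ^ 2 / 2 with hc
  have hcpos : 0 < c := by positivity
  set g : ℝ → ℝ := fun b => χ * (√(2 * π))⁻¹ * Real.exp (-c * b ^ 2) with hg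
  set F : ℝ → ℝ := fun b => -(Real.exp (-b ^ 2 / Ω) * Q (χ * b)) with hF
  have hd : ∀ b ∈ Ici (0:ℝ), HasDerivAt F ((2 * b / Ω) * Real.exp (-b ^ 2 / Ω) * Q (χ * b) + g b) b := by
    intro b _
    have h1 : HasDerivAt (fun b : ℝ => Real.exp (-b ^ 2 / Ω)) (Real.exp (-b ^ 2 / Ω) * (-(2 * b) / Ω)) b := by
      have := (((hasDerivAt_pow 2 b).neg).div_const Ω).exp
      simpa using this
    have h2 : HasDerivAt (fun b => Q (χ * b)) (-((Real.sqrt (2 * Real.pi))⁻¹ * Real.exp (-(χ * b) ^ 2 / 2) * χ)) b := by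
      have h3 : HasDerivAt (fun b : ℝ => χ * b) χ b := by simpa using (hasDerivAt_id b).const_mul χ
      exact (((Phi_deriv (χ * b)).comp b h3).const_sub 1)
    have := (h1.mul h2).neg
    refine this.congr_deriv ?_
    have e : Real.exp (-c * b ^ 2) = Real.exp (-b ^ 2 / Ω) * Real.exp (-(χ * b) ^ 2 / 2) := by
      rw [← Real.exp_add, hc]; congr 1; ring
    simp only [hg, e]; ring
  have hQ0 : ∀ x, 0 ≤ Q x := fun x => by unfold Q; linarith [Phi_le_one x]
  have hQ1 : ∀ x, Q x ≤ 1 := fun x => by unfold Q; linarith [Phi_nonneg x]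
  have hnn : ∀ b ∈ Ioi (0:ℝ), 0 ≤ (2 * b / Ω) * Real.exp (-b ^ 2 / Ω) * Q (χ * b) + g b := by
    intro b hb
    have hb : 0 < b := hb
    have := hQ0 (χ * b)
    positivity
  have hexp : Tendsto (fun b : ℝ => Real.exp (-b ^ 2 / Ω)) atTop (nhds 0) := by
    apply Real.tendsto_exp_atBot.comp
    have : Tendsto (fun b : ℝ => b ^ 2 / Ω) atTop atTop :=
      (tendsto_pow_atTop (by norm_num)).atTop_div_const hΩ
    refine (tendsto_neg_atTop_atBot.comp this).congr fun b => ?_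
    simp [neg_div]
  have hlim : Tendsto F atTop (nhds 0) := by
    have : Tendsto (fun b => Real.exp (-b ^ 2 / Ω) * Q (χ * b)) atTop (nhds 0) :=
      squeeze_zero (fun b => mul_nonneg (Real.exp_pos _).le (hQ0 _))
        (fun b => mul_le_of_le_one_right (Real.exp_pos _).le (hQ1 _)) hexp
    simpa using this.neg
  have hint := integrableOn_Ioi_deriv_of_nonneg' hd hnn hlim
  have hval := integral_Ioi_of_hasDerivAt_of_tendsto' hd hint hlim
  have hgi : IntegrableOn g (Ioi 0) :=
    ((integrable_exp_neg_mul_sq hcpos).const_mul _).integrableOn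
  have hgv : ∫ b in Ioi (0:ℝ), g b = χ * (√(2 * π))⁻¹ * (√(π / c) / 2) := by
    rw [hg, integral_const_mul, integral_gaussian_Ioi]
  have hsub := integral_sub hint hgi
  simp only [add_sub_cancel_right] at hsub
  rw [hsub, hval, hgv]
  have hF0 : F 0 = -(1/2) := by simp [hF, Q, Phi_zero]; norm_num
  have hs : √(χ ^ 2 * Ω / (2 + χ ^ 2 * Ω)) = χ * (√(2 * π))⁻¹ * √(π / c) := by
    rw [Real.sqrt_eq_iff_mul_self_eq (by positivity) (by positivity)]
    have h1 : √(2 * π) * √(2 * π) = 2 * π := Real.mul_self_sqrt (by positivity)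
    have h2 : √(π / c) * √(π / c) = π / c := Real.mul_self_sqrt (by positivity)
    symm
    calc _ = χ ^ 2 * (√(2 * π) * √(2 * π))⁻¹ * (√(π / c) * √(π / c)) := by rw [mul_inv]; ring
      _ = _ := by
        rw [h1, h2, hc]
        field_simp
  rw [hF0, hs]; ring

/-- Rayleigh-averaged Q-function: E_β[Q(χβ)] = (1/2)(1 − μ) with
μ = √(χ²Ω/(2+χ²Ω)); in particular for χ = λ/σ and γ̄ = Ω/σ². -/
theorem rayleigh_averaged_Q (Ω χ μ : ℝ) (hΩ : 0 < Ω) (hχ : 0 < χ)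
    (hμ : μ = Real.sqrt (χ ^ 2 * Ω / (2 + χ ^ 2 * Ω))) :
    (∫ b in Set.Ioi (0:ℝ), (2 * b / Ω) * Real.exp (-b ^ 2 / Ω) * Q (χ * b))
      = 1 / 2 * (1 - μ) ∧
    ∀ lam σ : ℝ, 0 < lam → 0 < σ → χ = lam / σ →
      (∫ b in Set.Ioi (0:ℝ), (2 * b / Ω) * Real.exp (-b ^ 2 / Ω) * Q (b * lam / σ))
        = 1 / 2 * (1 - Real.sqrt (lam ^ 2 * (Ω / σ ^ 2) / (2 + lam ^ 2 * (Ω / σ ^ 2)))) := by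
  subst hμ
  refine ⟨main_int Ω χ hΩ hχ, ?_⟩
  intro lam σ hl hσ h
  have := main_int Ω χ hΩ hχ
  have e : ∀ b : ℝ, b * lam / σ = χ * b := fun b => by rw [h]; ring
  have e2 : lam ^ 2 * (Ω / σ ^ 2) = χ ^ 2 * Ω := by rw [h]; ring
  simp_rw [e, e2]
  exact this
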